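/- For the random vector X = (X₁, X₂) with distribution P, the coordinate variances are V(X₁) = ∫ (x₁ − 1/2)² dP = 3/44 and V(X₂) = ∫ (x₂ − √3/4)² dP = 15/176, and the expected squared distance from the mean is V = ∫ ‖(x₁,x₂) − (1/2, √3/4)‖² dP(x₁,x₂) = 27/176, where ‖·‖ is the Euclidean norm on ℝ². -/

import Mathlib

open MeasureTheory Real Set
open scoped ENNReal NNReal

/-- The three contractive similarities generating the nonhomogeneous R-triangle.
Letters 1,2,3 of the paper correspond to `0,1,2 : Fin 3`. -/
noncomputable def Smap : Fin 3 → ℝ × ℝ → ℝ × ℝ :=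
  ![fun x => (x.1 / 4, x.2 / 4),
    fun x => (x.1 / 4 + 3 / 4, x.2 / 4),
    fun x => (x.1 / 2 + 1 / 4, x.2 / 2 + Real.sqrt 3 / 4)]

/-- `Sw ω = S_{ω₁} ∘ ⋯ ∘ S_{ω_k}` for a word `ω = ω₁⋯ω_k`. -/
noncomputable def Sw (ω : List (Fin 3)) : ℝ × ℝ → ℝ × ℝ :=
  (ω.map Smap).foldr (· ∘ ·) id

/-- The probability weights `p₁ = p₂ = 1/5`, `p₃ = 3/5`. -/
noncomputable def pr : Fin 3 → ℝ := ![1/5, 1/5, 3/5]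

/-- The similarity ratios `s₁ = s₂ = 1/4`, `s₃ = 1/2`. -/
noncomputable def sr : Fin 3 → ℝ := ![1/4, 1/4, 1/2]

/-- `p_ω = p_{ω₁}⋯p_{ω_k}`. -/
noncomputable def pw (ω : List (Fin 3)) : ℝ := (ω.map pr).prod

/-- `s_ω = s_{ω₁}⋯s_{ω_k}`. -/
noncomputable def sw (ω : List (Fin 3)) : ℝ := (ω.map sr).prod

/-- `P` is the nonhomogeneous R-measure:
`P = (1/5)·P∘S₁⁻¹ + (1/5)·P∘S₂⁻¹ + (3/5)·P∘S₃⁻¹`. -/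
def IsRMeasure (P : Measure (ℝ × ℝ)) : Prop :=
  P = (1/5 : ℝ≥0∞) • P.map (Smap 0) + (1/5 : ℝ≥0∞) • P.map (Smap 1)
        + (3/5 : ℝ≥0∞) • P.map (Smap 2)

/-- The closed equilateral triangle with vertices (0,0), (1,0), (1/2, √3/2). -/
noncomputable def Δtri : Set (ℝ × ℝ) :=
  convexHull ℝ ({(0, 0), (1, 0), (1/2, Real.sqrt 3 / 2)} : Set (ℝ × ℝ))

/-- Squared Euclidean distance on ℝ². -/
def sqDist (x a : ℝ × ℝ) : ℝ := (x.1 - a.1) ^ 2 + (x.2 - a.2) ^ 2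

lemma continuous_Smap (i : Fin 3) : Continuous (Smap i) := by
  fin_cases i <;> simp only [Smap] <;> dsimp <;> fun_prop

lemma norm_Smap_le (i : Fin 3) (x : ℝ × ℝ) : ‖Smap i x‖ ≤ ‖x‖ / 2 + 3 / 4 := by
  have h1 := abs_le.mp (norm_fst_le x)
  have h2 := abs_le.mp (norm_snd_le x)
  have h0 := norm_nonneg x
  have h3 : Real.sqrt 3 ≤ 3 := Real.sqrt_le_iff.mpr (by norm_num)
  have h4 := Real.sqrt_nonneg 3
  rw [Prod.norm_def, max_le_iff, Real.norm_eq_abs, Real.norm_eq_abs, abs_le, abs_le]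
  fin_cases i <;> simp [Smap] <;> refine ⟨⟨?_, ?_⟩, ?_, ?_⟩ <;> linarith

namespace IsRMeasure

variable {P : Measure (ℝ × ℝ)}

lemma measure_lt_norm_le (hP : IsRMeasure P) (s : ℝ) :
    P {x | 3 / 2 + s < ‖x‖} ≤ P {x | 3 / 2 + 2 * s < ‖x‖} := by
  have hmeas : MeasurableSet {x : ℝ × ℝ | 3 / 2 + s < ‖x‖} :=
    measurableSet_lt measurable_const measurable_norm
  have key (i : Fin 3) : P.map (Smap i) {x | 3 / 2 + s < ‖x‖} ≤ P {x | 3 / 2 + 2 * s < ‖x‖} := by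
    rw [Measure.map_apply (continuous_Smap i).measurable hmeas]
    refine measure_mono fun x hx => ?_
    simp only [mem_preimage, mem_ofPred_eq] at hx ⊢
    linarith [norm_Smap_le i x]
  have hsum : (1 / 5 + 1 / 5 + 3 / 5 : ℝ≥0∞) = 1 := by
    rw [ENNReal.div_add_div_same, ENNReal.div_add_div_same]
    norm_num
    exact ENNReal.div_self (by norm_num) (by norm_num)
  calc P {x | 3 / 2 + s < ‖x‖}
      = 1 / 5 * P.map (Smap 0) {x | 3 / 2 + s < ‖x‖}
        + 1 / 5 * P.map (Smap 1) {x | 3 / 2 + s < ‖x‖}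
        + 3 / 5 * P.map (Smap 2) {x | 3 / 2 + s < ‖x‖} := by
        conv_lhs => rw [hP]
        rfl
    _ ≤ 1 / 5 * P {x | 3 / 2 + 2 * s < ‖x‖} + 1 / 5 * P {x | 3 / 2 + 2 * s < ‖x‖}
        + 3 / 5 * P {x | 3 / 2 + 2 * s < ‖x‖} := by
        exact add_le_add (add_le_add (mul_le_mul_right (key 0) _) (mul_le_mul_right (key 1) _))
          (mul_le_mul_right (key 2) _)
    _ = P {x | 3 / 2 + 2 * s < ‖x‖} := by
        rw [← add_mul, ← add_mul, hsum, one_mul]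

lemma measure_lt_norm_eq_zero [IsFiniteMeasure P] (hP : IsRMeasure P) {s : ℝ} (hs : 0 < s) :
    P {x | 3 / 2 + s < ‖x‖} = 0 := by
  have hle (n : ℕ) : P {x | 3 / 2 + s < ‖x‖} ≤ P {x | 3 / 2 + 2 ^ n * s < ‖x‖} := by
    induction n with
    | zero => simp
    | succ n ih =>
      refine ih.trans ((hP.measure_lt_norm_le _).trans_eq ?_)
      rw [pow_succ', mul_assoc]
  have hlim : Filter.Tendsto (fun n : ℕ => P {x | 3 / 2 + 2 ^ n * s < ‖x‖}) Filter.atTop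
      (nhds (P (⋂ n : ℕ, {x | 3 / 2 + 2 ^ n * s < ‖x‖}))) := by
    refine tendsto_measure_iInter_atTop (fun n => ?_) (fun m n hmn x hx => ?_)
      ⟨0, measure_ne_top _ _⟩
    · exact (measurableSet_lt measurable_const measurable_norm).nullMeasurableSet
    · simp only [mem_ofPred_eq] at hx ⊢
      have : (2 : ℝ) ^ m * s ≤ 2 ^ n * s := by gcongr; norm_num
      linarith
  have hempty : (⋂ n : ℕ, {x : ℝ × ℝ | 3 / 2 + 2 ^ n * s < ‖x‖}) = ∅ := by
    refine eq_empty_of_forall_notMem fun x hx => ?_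
    obtain ⟨n, hn⟩ := pow_unbounded_of_one_lt (‖x‖ / s) (one_lt_two : (1 : ℝ) < 2)
    have h := mem_iInter.mp hx n
    rw [div_lt_iff₀ hs] at hn
    simp only [mem_ofPred_eq] at h
    linarith
  rw [hempty, measure_empty] at hlim
  exact le_antisymm (ge_of_tendsto' hlim hle) zero_le

lemma integrable_of_continuous [IsFiniteMeasure P] (hP : IsRMeasure P) {f : ℝ × ℝ → ℝ}
    (hf : Continuous f) : Integrable f P := by
  have hmem : ∀ᵐ x ∂P, x ∈ Metric.closedBall (0 : ℝ × ℝ) (3 / 2 + 1) := by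
    rw [ae_iff]
    simpa only [mem_closedBall_zero_iff, not_le] using hP.measure_lt_norm_eq_zero one_pos
  rw [← Measure.restrict_eq_self_of_ae_mem hmem]
  exact hf.continuousOn.integrableOn_compact (isCompact_closedBall _ _)

lemma integral_eq [IsFiniteMeasure P] (hP : IsRMeasure P) {f : ℝ × ℝ → ℝ} (hf : Continuous f) :
    ∫ x, f x ∂P = 1 / 5 * ∫ x, f (Smap 0 x) ∂P + 1 / 5 * ∫ x, f (Smap 1 x) ∂P
      + 3 / 5 * ∫ x, f (Smap 2 x) ∂P := by
  have hint (i : Fin 3) : Integrable f (P.map (Smap i)) :=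
    (integrable_map_measure hf.aestronglyMeasurable (continuous_Smap i).aemeasurable).mpr
      (hP.integrable_of_continuous (hf.comp (continuous_Smap i)))
  have hmap (i : Fin 3) : ∫ x, f x ∂(P.map (Smap i)) = ∫ x, f (Smap i x) ∂P :=
    integral_map (continuous_Smap i).aemeasurable hf.aestronglyMeasurable
  have h1 : (1 / 5 : ℝ≥0∞) ≠ ∞ := ENNReal.div_ne_top (by norm_num) (by norm_num)
  have h3 : (3 / 5 : ℝ≥0∞) ≠ ∞ := ENNReal.div_ne_top (by norm_num) (by norm_num)
  have i0 := (hint 0).smul_measure h1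
  have i1 := (hint 1).smul_measure h1
  have i2 := (hint 2).smul_measure h3
  conv_lhs => rw [hP]
  rw [integral_add_measure (i0.add_measure i1) i2, integral_add_measure i0 i1,
    integral_smul_measure, integral_smul_measure, integral_smul_measure, hmap, hmap, hmap]
  simp [ENNReal.toReal_div]

lemma integral_quadratic [IsProbabilityMeasure P] (hP : IsRMeasure P) {u : ℝ × ℝ → ℝ}
    (hu : Continuous u) (a b c : ℝ) :
    ∫ x, (a * u x ^ 2 + b * u x + c) ∂P = a * ∫ x, u x ^ 2 ∂P + b * ∫ x, u x ∂P + c := by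
  have h2 : Integrable (fun x => a * u x ^ 2) P := hP.integrable_of_continuous (by fun_prop)
  have h1 : Integrable (fun x => b * u x) P := hP.integrable_of_continuous (by fun_prop)
  rw [integral_add (by exact h2.add h1) (integrable_const c), integral_add h2 h1,
    integral_const_mul, integral_const_mul]
  simp

/-- A centred coordinate `u` that each similarity transforms affinely satisfies the resulting
linear relations for its first two moments. -/
lemma moments_of_affine [IsProbabilityMeasure P] (hP : IsRMeasure P) {u : ℝ × ℝ → ℝ}
    (hu : Continuous u) {d₀ d₁ d₂ : ℝ} (h₀ : ∀ x, u (Smap 0 x) = u x / 4 + d₀)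
    (h₁ : ∀ x, u (Smap 1 x) = u x / 4 + d₁) (h₂ : ∀ x, u (Smap 2 x) = u x / 2 + d₂)
    (hd : d₀ + d₁ + 3 * d₂ = 0) :
    ∫ x, u x ^ 2 ∂P = 8 / 33 * (d₀ ^ 2 + d₁ ^ 2 + 3 * d₂ ^ 2) := by
  have lin (a b : ℝ) : ∫ x, (u x / a + b) ∂P = (∫ x, u x ∂P) / a + b := by
    have := hP.integral_quadratic hu 0 (1 / a) b
    simp only [zero_mul, zero_add] at this
    convert this using 1
    · congr 1; ext x; ring
    · ring
  have sq (a b : ℝ) : ∫ x, (u x / a + b) ^ 2 ∂P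
      = (∫ x, u x ^ 2 ∂P) / a ^ 2 + 2 * b / a * ∫ x, u x ∂P + b ^ 2 := by
    have := hP.integral_quadratic hu (1 / a ^ 2) (2 * b / a) (b ^ 2)
    convert this using 1
    · congr 1; ext x; ring
    · ring
  have m1 := hP.integral_eq hu
  have m2 := hP.integral_eq (f := fun x => u x ^ 2) (by fun_prop)
  simp only [h₀, h₁, h₂, lin] at m1
  simp only [h₀, h₁, h₂, sq] at m2
  have hmean : ∫ x, u x ∂P = 0 := by linarith
  rw [hmean] at m2
  linarith

end IsRMeasure

/-- `V(X₁) = 3/44`, `V(X₂) = 15/176`, and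
`V = ∫ ‖x − (1/2, √3/4)‖² dP = 27/176` (Euclidean norm). -/
theorem stmt_5 (P : Measure (ℝ × ℝ)) [IsProbabilityMeasure P] (hP : IsRMeasure P) :
    (∫ x : ℝ × ℝ, (x.1 - 1/2) ^ 2 ∂P) = 3/44 ∧
    (∫ x : ℝ × ℝ, (x.2 - Real.sqrt 3 / 4) ^ 2 ∂P) = 15/176 ∧
    (∫ x : ℝ × ℝ, sqDist x (1/2, Real.sqrt 3 / 4) ∂P) = 27/176 := by
  have hX := hP.moments_of_affine (u := fun x => x.1 - 1/2) (d₀ := -3/8) (d₁ := 3/8) (d₂ := 0)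
    (by fun_prop) (fun x => by simp [Smap]; ring) (fun x => by simp [Smap]; ring)
    (fun x => by simp [Smap]; ring) (by norm_num)
  have hY := hP.moments_of_affine (u := fun x => x.2 - Real.sqrt 3 / 4)
    (d₀ := -3 * Real.sqrt 3 / 16) (d₁ := -3 * Real.sqrt 3 / 16) (d₂ := Real.sqrt 3 / 8)
    (by fun_prop) (fun x => by simp [Smap]; ring) (fun x => by simp [Smap]; ring)
    (fun x => by simp [Smap]; ring) (by ring)
  have h3 : Real.sqrt 3 ^ 2 = 3 := Real.sq_sqrt (by norm_num)
  have hX' : (∫ x : ℝ × ℝ, (x.1 - 1/2) ^ 2 ∂P) = 3/44 := by rw [hX]; norm_num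
  have hY' : (∫ x : ℝ × ℝ, (x.2 - Real.sqrt 3 / 4) ^ 2 ∂P) = 15/176 := by
    rw [hY]; linear_combination (5 / 176) * h3
  refine ⟨hX', hY', ?_⟩
  simp only [sqDist]
  rw [integral_add (hP.integrable_of_continuous (by fun_prop))
    (hP.integrable_of_continuous (by fun_prop)), hX', hY']
  norm_num
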